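/- Let P₁ and P₂ be probability measures on ℝ^m with P₂ ≪ P₁, let λ ≠ 0, assume K_{h,P₁,x}(−λ) is finite, and assume h(x,·) is integrable with respect to P₁, P₂, and the (h,P₁,λ)-Gibbs probability measure P^{(h,P₁,λ)}_{Y|X=x}, and that D(P₂‖P₁) is finite. Then G_h(x, P₁, P₂) = (1/λ) ( D(P₁‖P^{(h,P₁,λ)}_{Y|X=x}) − D(P₂‖P^{(h,P₁,λ)}_{Y|X=x}) + D(P₂‖P₁) ). -/

import Mathlib

open MeasureTheory Real ProbabilityTheory

/-- Real-valued relative entropy (KL divergence) `D(μ‖ν) = ∫ log (dμ/dν) dμ`. -/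
noncomputable def klDivR {α : Type*} [MeasurableSpace α] (μ ν : Measure α) : ℝ :=
  ∫ y, Real.log ((μ.rnDeriv ν y).toReal) ∂μ

/-- `cgfK h Q x t = K_{h,Q,x}(t) = log ∫ exp (t * h x y) dQ(y)`. -/
noncomputable def cgfK {n m : ℕ} (h : (Fin n → ℝ) → (Fin m → ℝ) → ℝ)
    (Q : Measure (Fin m → ℝ)) (x : Fin n → ℝ) (t : ℝ) : ℝ :=
  Real.log (∫ y, Real.exp (t * h x y) ∂Q)

/-- The `(h,Q,λ)`-Gibbs probability measure `P^{(h,Q,λ)}_{Y|X=x}`, which has density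
`exp (-λ * h(x,y) - K_{h,Q,x}(-λ))` with respect to `Q`. -/
noncomputable def gibbs {n m : ℕ} (h : (Fin n → ℝ) → (Fin m → ℝ) → ℝ)
    (Q : Measure (Fin m → ℝ)) (lam : ℝ) (x : Fin n → ℝ) : Measure (Fin m → ℝ) :=
  Q.withDensity fun y => ENNReal.ofReal (Real.exp (-lam * h x y - cgfK h Q x (-lam)))

theorem gibbs_eq_tilted {n m : ℕ} {h : (Fin n → ℝ) → (Fin m → ℝ) → ℝ}
    {Q : Measure (Fin m → ℝ)} {lam : ℝ} {x : Fin n → ℝ}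
    (hpos : 0 < ∫ y, Real.exp (-lam * h x y) ∂Q) :
    gibbs h Q lam x = Q.tilted (fun y => -lam * h x y) := by
  simp only [gibbs, cgfK, Measure.tilted, Real.exp_sub, Real.exp_log hpos]

theorem klDivR_gibbs {n m : ℕ} {h : (Fin n → ℝ) → (Fin m → ℝ) → ℝ}
    {Q P : Measure (Fin m → ℝ)} [SigmaFinite Q] [IsProbabilityMeasure P] (hac : P ≪ Q)
    {lam : ℝ} {x : Fin n → ℝ}
    (hKint : Integrable (fun y => Real.exp (-lam * h x y)) Q)
    (hKpos : 0 < ∫ y, Real.exp (-lam * h x y) ∂Q)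
    (hInt : Integrable (h x) P) (hKL : Integrable (llr P Q) P) :
    klDivR P (gibbs h Q lam x)
      = klDivR P Q + lam * (∫ y, h x y ∂P) + cgfK h Q x (-lam) := by
  have key := integral_llr_tilted_right hac (hInt.const_mul (-lam)) hKint hKL
  rw [integral_const_mul] at key
  simp only [llr_def] at key
  rw [klDivR, gibbs_eq_tilted hKpos, key, klDivR, cgfK]
  ring

theorem klDivR_self {α : Type*} [MeasurableSpace α] (μ : Measure α) [SigmaFinite μ] :
    klDivR μ μ = 0 :=
  integral_eq_zero_of_ae (llr_self μ)

theorem stmt9 {n m : ℕ} (h : (Fin n → ℝ) → (Fin m → ℝ) → ℝ)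
    (hMeas : Measurable (Function.uncurry h))
    (P₁ P₂ : Measure (Fin m → ℝ)) [IsProbabilityMeasure P₁] [IsProbabilityMeasure P₂]
    (hac : P₂ ≪ P₁)
    (x : (Fin n → ℝ)) (lam : ℝ) (hlam : lam ≠ 0)
    (hKint : Integrable (fun y => Real.exp (-lam * h x y)) P₁)
    (hKpos : 0 < ∫ y, Real.exp (-lam * h x y) ∂P₁)
    (hInt1 : Integrable (h x) P₁) (hInt2 : Integrable (h x) P₂)
    (hGint : Integrable (h x) (gibbs h P₁ lam x))
    (hKL : Integrable (fun y => Real.log ((P₂.rnDeriv P₁ y).toReal)) P₂) :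
    (∫ y, h x y ∂P₁) - (∫ y, h x y ∂P₂)
      = (1 / lam) * (klDivR P₁ (gibbs h P₁ lam x) - klDivR P₂ (gibbs h P₁ lam x)
          + klDivR P₂ P₁) := by
  have hself : Integrable (llr P₁ P₁) P₁ :=
    (integrable_zero _ _ _).congr (llr_self P₁).symm
  rw [klDivR_gibbs .rfl hKint hKpos hInt1 hself,
    klDivR_gibbs hac hKint hKpos hInt2 hKL, klDivR_self]
  field_simp
  ring
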